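/- Let ω be a weight function with constant K, τ ∈ (0,1), and 1 ≤ p ≤ ∞. For every λ ≥ 0 and f ∈ 𝒮_ω(ℝᴺ): ‖e^{λω} Wig_τ(f)‖_∞² ≤ (2π)^{−N}(τ−τ²)^{−N} e^{K(1+2K)λ} ‖e^{4K²λω} Rf‖_p ‖e^{4K²λω} Rf‖_{p'}. -/

import Mathlib

open MeasureTheory Complex ENNReal

noncomputable section

abbrev RN (N : ℕ) := Fin N → ℝ

def dotR {N : ℕ} (x y : RN N) : ℝ := ∑ i, x i * y i

def stft {N : ℕ} (g f : RN N → ℂ) (x ξ : RN N) : ℂ :=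
  ∫ y, f y * (starRingEnd ℂ) (g (y - x)) * Complex.exp (-(Complex.I * (dotR y ξ : ℂ)))

def ftr {N : ℕ} (f : RN N → ℂ) (ξ : RN N) : ℂ :=
  ∫ x, Complex.exp (-(Complex.I * (dotR x ξ : ℂ))) * f x

def rihaczek {N : ℕ} (f : RN N → ℂ) (x ξ : RN N) : ℂ :=
  Complex.exp (-(Complex.I * (dotR x ξ : ℂ))) * f x * (starRingEnd ℂ) (ftr f ξ)

def spec {N : ℕ} (g f : RN N → ℂ) (x ξ : RN N) : ℝ := ‖stft g f x ξ‖ ^ 2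

def wig {N : ℕ} (τ : ℝ) (f : RN N → ℂ) (x ξ : RN N) : ℂ :=
  ∫ t, Complex.exp (-(Complex.I * (dotR t ξ : ℂ))) * f (x + τ • t) *
    (starRingEnd ℂ) (f (x - (1 - τ) • t))

structure WeightFunction where
  w : ℝ → ℝ
  K : ℝ
  a : ℝ
  b : ℝ
  oneLeK : 1 ≤ K
  bpos : 0 < b
  cont : Continuous w
  mono : MonotoneOn w (Set.Ici 0)
  nonneg : ∀ t, 0 ≤ w t
  alpha : ∀ t, 0 ≤ t → w (2 * t) ≤ K * (1 + w t)
  beta : Filter.Tendsto (fun t => w t / t) Filter.atTop (nhds 0)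
  gamma : ∀ t, 0 ≤ t → a + b * Real.log (1 + t) ≤ w t
  delta : ConvexOn ℝ Set.univ (fun t => w (Real.exp t))
  subadd : ∀ s t, 0 ≤ s → 0 ≤ t → w (s + t) ≤ K * (1 + w s + w t)

def wnorm (W : WeightFunction) (lam : ℝ) {E : Type*} [NormedAddCommGroup E]
    [MeasurableSpace E] (μ : Measure E) {F : Type*} [NormedAddCommGroup F]
    (f : E → F) (p : ℝ≥0∞) : ℝ≥0∞ :=
  eLpNorm (fun t => Real.exp (lam * W.w ‖t‖) * ‖f t‖) p μ

def SOmega {N : ℕ} (W : WeightFunction) (f : RN N → ℂ) : Prop :=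
  ∀ lam : ℝ, 0 < lam →
    (∃ C, ∀ x, Real.exp (lam * W.w ‖x‖) * ‖f x‖ ≤ C) ∧
    (∃ C, ∀ ξ, Real.exp (lam * W.w ‖ξ‖) * ‖ftr f ξ‖ ≤ C)

def elpN {α : Type*} [MeasurableSpace α] (μ : Measure α) (h : α → ℝ≥0∞) (p : ℝ≥0∞) : ℝ≥0∞ :=
  if p = ∞ then essSup h μ else (∫⁻ z, (h z) ^ p.toReal ∂μ) ^ (1 / p.toReal)

end


section PhaseSpace

variable {N : ℕ}

lemma dotR_add_left (x y z : RN N) : dotR (x + y) z = dotR x z + dotR y z := by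
  simp [dotR, add_mul, Finset.sum_add_distrib]

lemma dotR_smul_left (r : ℝ) (x z : RN N) : dotR (r • x) z = r * dotR x z := by
  simp [dotR, Finset.mul_sum, mul_assoc]

lemma dotR_comm (x y : RN N) : dotR x y = dotR y x := by
  simp [dotR, mul_comm]

lemma continuous_dotR : Continuous fun z : RN N × RN N => dotR z.1 z.2 := by
  unfold dotR
  fun_prop

lemma norm_exp_neg_I_mul (r : ℝ) : ‖Complex.exp (-(Complex.I * (r : ℂ)))‖ = 1 := by
  have := Complex.norm_exp_ofReal_mul_I (-r)
  rwa [show ((-r : ℝ) : ℂ) * I = -(I * (r : ℂ)) by push_cast; ring] at this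

lemma norm_exp_I_mul (r : ℝ) : ‖Complex.exp (Complex.I * (r : ℂ))‖ = 1 := by
  rw [mul_comm, Complex.norm_exp_ofReal_mul_I]

lemma inner_toLp (x y : RN N) :
    inner ℝ (WithLp.toLp 2 x : EuclideanSpace ℝ (Fin N)) (WithLp.toLp 2 y) = dotR x y := by
  simp [PiLp.inner_apply, dotR, mul_comm]

open FourierTransform in
/-- The Fourier transform `ftr` and its inversion formula, expressed through Mathlib's Fourier
transform on Euclidean space. -/
lemma exists_schwartz_ftr (f : SchwartzMap (RN N) ℂ) :
    ∃ h : SchwartzMap (EuclideanSpace ℝ (Fin N)) ℂ,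
      (∀ v : RN N, ftr f ((2 * Real.pi) • v) = h (WithLp.toLp 2 v)) ∧
      ∀ u : RN N, f u = ∫ v : RN N,
        Complex.exp (Complex.I * (dotR ((2 * Real.pi) • v) u : ℂ)) * h (WithLp.toLp 2 v) := by
  let g : SchwartzMap (EuclideanSpace ℝ (Fin N)) ℂ :=
    SchwartzMap.compCLMOfContinuousLinearEquiv ℝ (EuclideanSpace.equiv (Fin N) ℝ) f
  have hg : ∀ x : RN N, g (WithLp.toLp 2 x) = f x := fun x => rfl
  have emb : MeasurableEmbedding (WithLp.toLp 2 : RN N → EuclideanSpace ℝ (Fin N)) :=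
    (MeasurableEquiv.toLp 2 (RN N)).measurableEmbedding
  have mp := PiLp.volume_preserving_toLp (Fin N)
  refine ⟨𝓕 g, fun v => ?_, fun u => ?_⟩
  · rw [SchwartzMap.fourier_coe, Real.fourier_eq', ← mp.integral_comp emb, ftr]
    refine integral_congr_ae (.of_forall fun x => ?_)
    simp only [hg, inner_toLp, smul_eq_mul]
    congr 2
    rw [dotR_comm, dotR_smul_left, dotR_comm]
    push_cast
    ring
  · have h := congrArg (fun k : SchwartzMap (EuclideanSpace ℝ (Fin N)) ℂ => k (WithLp.toLp 2 u))
      (FourierTransform.fourierInv_fourier_eq (F := SchwartzMap (EuclideanSpace ℝ (Fin N)) ℂ) g)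
    simp only [hg] at h
    rw [← h, SchwartzMap.fourierInv_coe, Real.fourierInv_eq', ← mp.integral_comp emb]
    refine integral_congr_ae (.of_forall fun x => ?_)
    simp only [inner_toLp, smul_eq_mul]
    congr 2
    rw [dotR_smul_left]
    push_cast
    ring

lemma continuous_ftr (f : SchwartzMap (RN N) ℂ) : Continuous (ftr f) := by
  obtain ⟨h, h1, -⟩ := exists_schwartz_ftr f
  have : ftr f = fun η => h (WithLp.toLp 2 ((2 * Real.pi)⁻¹ • η)) := by
    ext η
    rw [← h1, smul_inv_smul₀ (by positivity)]
  rw [this]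
  have := h.continuous
  have h2 : Continuous (WithLp.toLp 2 : RN N → EuclideanSpace ℝ (Fin N)) :=
    PiLp.continuous_toLp 2 _
  exact this.comp (h2.comp (continuous_const_smul _))

lemma integrable_ftr (f : SchwartzMap (RN N) ℂ) : Integrable (ftr f) := by
  obtain ⟨h, h1, -⟩ := exists_schwartz_ftr f
  rw [← integrable_comp_smul_iff volume (ftr f) (R := 2 * Real.pi) (by positivity)]
  simp only [h1]
  exact (PiLp.volume_preserving_toLp (Fin N)).integrable_comp_of_integrable h.integrable

lemma ftr_inversion (f : SchwartzMap (RN N) ℂ) (u : RN N) :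
    f u = (((2 * Real.pi) ^ N)⁻¹ : ℝ) *
      ∫ η, Complex.exp (Complex.I * (dotR η u : ℂ)) * ftr f η := by
  obtain ⟨h, h1, h2⟩ := exists_schwartz_ftr f
  rw [h2 u]
  simp only [← h1]
  rw [Measure.integral_comp_smul volume
    (fun η => Complex.exp (Complex.I * (dotR η u : ℂ)) * ftr f η)]
  rw [Complex.real_smul, Module.finrank_fin_fun, abs_of_pos (by positivity)]

/-- Fourier transform of a translated dilate, up to a unimodular factor. -/
lemma norm_ftr_affine (f : RN N → ℂ) {τ : ℝ} (hτ : 0 < τ) (x ζ : RN N) :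
    ‖∫ t, Complex.exp (-(Complex.I * (dotR t ζ : ℂ))) * f (x + τ • t)‖ =
      (τ ^ N)⁻¹ * ‖ftr f (τ⁻¹ • ζ)‖ := by
  have key : ∀ t : RN N, Complex.exp (-(Complex.I * (dotR t ζ : ℂ))) * f (x + τ • t) =
      Complex.exp (Complex.I * (dotR x (τ⁻¹ • ζ) : ℂ)) *
        (Complex.exp (-(Complex.I * (dotR (x + τ • t) (τ⁻¹ • ζ) : ℂ))) * f (x + τ • t)) := by
    intro t
    rw [← mul_assoc, ← Complex.exp_add]
    congr 2
    rw [dotR_add_left, dotR_smul_left, dotR_comm t (τ⁻¹ • ζ), dotR_smul_left, dotR_comm ζ,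
      mul_inv_cancel_left₀ hτ.ne']
    push_cast
    ring
  simp only [key]
  rw [integral_const_mul, norm_mul, norm_exp_I_mul, one_mul]
  rw [Measure.integral_comp_smul volume (fun y => Complex.exp
    (-(Complex.I * (dotR (x + y) (τ⁻¹ • ζ) : ℂ))) * f (x + y)),
    integral_add_left_eq_self (fun y => Complex.exp
    (-(Complex.I * (dotR y (τ⁻¹ • ζ) : ℂ))) * f y), norm_smul, Module.finrank_fin_fun,
    Real.norm_eq_abs, abs_abs, abs_of_pos (by positivity), ftr]

lemma map_smul_volume (r : ℝ) (hr : r ≠ 0) :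
    Measure.map (fun x : RN N => r • x) volume = ENNReal.ofReal |(r ^ N)⁻¹| • volume := by
  have := Measure.map_addHaar_smul (volume : Measure (RN N)) hr
  rwa [Module.finrank_fin_fun] at this

lemma lintegral_eq_smul (g : RN N → ℝ≥0∞) (hg : Measurable g) {r : ℝ} (hr : r ≠ 0) :
    ∫⁻ η, g η = ENNReal.ofReal |r ^ N| * ∫⁻ η, g (r • η) := by
  rw [← lintegral_map hg (measurable_const_smul r), map_smul_volume r hr, lintegral_smul_measure,
    smul_eq_mul, ← mul_assoc, ← ENNReal.ofReal_mul (abs_nonneg _), ← abs_mul,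
    mul_inv_cancel₀ (pow_ne_zero _ hr)]
  simp

/-- The hyperbolic scalings of phase space preserve volume. -/
lemma measurePreserving_hyperbolic (a b : RN N) {r : ℝ} (hr : r ≠ 0) :
    MeasurePreserving (fun z : RN N × RN N => (a + r • z.1, r⁻¹ • (b + z.2)))
      volume volume := by
  have h1 : MeasurePreserving (fun z : RN N × RN N => (r • z.1, r⁻¹ • z.2)) volume volume := by
    refine ⟨by fun_prop, ?_⟩
    change Measure.map (Prod.map (fun x : RN N => r • x) (fun x : RN N => r⁻¹ • x))
      ((volume : Measure (RN N)).prod volume) = (volume : Measure (RN N)).prod volume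
    have e1 := map_smul_volume (N := N) r hr
    have e2 := map_smul_volume (N := N) r⁻¹ (inv_ne_zero hr)
    have : SFinite (Measure.map (fun x : RN N => r • x) volume) := by rw [e1]; infer_instance
    rw [← Measure.map_prod_map _ _ (by fun_prop) (by fun_prop), e1, e2,
      Measure.prod_smul_left, Measure.prod_smul_right, smul_smul,
      ← ENNReal.ofReal_mul (abs_nonneg _), ← abs_mul]
    simp [hr]
  have h2 : MeasurePreserving (fun z : RN N × RN N => (a, 0) + z) volume volume :=
    measurePreserving_add_left ((volume : Measure (RN N)).prod volume) _
  have h3 : MeasurePreserving (fun z : RN N × RN N => (0, b) + z) volume volume :=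
    measurePreserving_add_left ((volume : Measure (RN N)).prod volume) _
  have := h2.comp (h1.comp h3)
  convert this using 1
  ext z <;> simp [mul_add]

lemma enorm_wig_le_lintegral (f : RN N → ℂ) (τ : ℝ) (x ξ : RN N) :
    ‖wig τ f x ξ‖ₑ ≤ ∫⁻ t, ‖f (x + τ • t)‖ₑ * ‖f (x - (1 - τ) • t)‖ₑ := by
  refine (enorm_integral_le_lintegral_enorm _).trans (le_of_eq ?_)
  refine lintegral_congr fun t => ?_
  rw [enorm_mul, enorm_mul, RCLike.enorm_conj, ← ofReal_norm, norm_exp_neg_I_mul]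
  simp

lemma wig_eq_integral_ftr (f : SchwartzMap (RN N) ℂ) {τ : ℝ} (hτ : 0 < τ) (x ξ : RN N) :
    wig τ f x ξ = (((2 * Real.pi) ^ N)⁻¹ : ℝ) *
      ∫ η, (Complex.exp (-(Complex.I * (dotR η x : ℂ))) * (starRingEnd ℂ) (ftr f η)) *
        ∫ t, Complex.exp (-(Complex.I * (dotR t (ξ - (1 - τ) • η) : ℂ))) * f (x + τ • t) := by
  have hsplit : ∀ t : RN N, Complex.exp (-(Complex.I * (dotR t ξ : ℂ))) * f (x + τ • t) *
      (starRingEnd ℂ) (f (x - (1 - τ) • t)) = (((2 * Real.pi) ^ N)⁻¹ : ℝ) *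
      ∫ η, (Complex.exp (-(Complex.I * (dotR η x : ℂ))) * (starRingEnd ℂ) (ftr f η)) *
        (Complex.exp (-(Complex.I * (dotR t (ξ - (1 - τ) • η) : ℂ))) * f (x + τ • t)) := by
    intro t
    rw [ftr_inversion f (x - (1 - τ) • t), map_mul, Complex.conj_ofReal, ← integral_conj,
      mul_left_comm, ← integral_const_mul]
    congr 1
    refine integral_congr_ae (.of_forall fun η => ?_)
    simp only [map_mul, ← Complex.exp_conj, Complex.conj_I, Complex.conj_ofReal]
    have e : Complex.exp (-(Complex.I * (dotR t ξ : ℂ))) *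
        Complex.exp (-Complex.I * (dotR η (x - (1 - τ) • t) : ℂ)) =
        Complex.exp (-(Complex.I * (dotR η x : ℂ))) *
        Complex.exp (-(Complex.I * (dotR t (ξ - (1 - τ) • η) : ℂ))) := by
      rw [← Complex.exp_add, ← Complex.exp_add]
      congr 1
      have s1 : dotR η (x - (1 - τ) • t) = dotR η x - (1 - τ) * dotR η t := by
        simp only [dotR, Pi.sub_apply, Pi.smul_apply, smul_eq_mul, Finset.mul_sum,
          ← Finset.sum_sub_distrib]
        exact Finset.sum_congr rfl fun i _ => by ring
      have s2 : dotR t (ξ - (1 - τ) • η) = dotR t ξ - (1 - τ) * dotR η t := by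
        simp only [dotR, Pi.sub_apply, Pi.smul_apply, smul_eq_mul, Finset.mul_sum,
          ← Finset.sum_sub_distrib]
        exact Finset.sum_congr rfl fun i _ => by ring
      rw [s1, s2]
      push_cast
      ring
    linear_combination (f (x + τ • t) * (starRingEnd ℂ) (ftr f η)) * e
  unfold wig
  simp only [hsplit]
  rw [integral_const_mul, integral_integral_swap]
  · simp only [integral_const_mul]
  have hf : Integrable fun t : RN N => f (x + τ • t) :=
    (integrable_comp_smul_iff volume (fun y => f (x + y)) hτ.ne').2
      (f.integrable.comp_add_left x)
  have hF := integrable_ftr f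
  have hd := continuous_dotR (N := N)
  have hfc := f.continuous
  have hFc := continuous_ftr f
  refine (hf.mul_prod hF).mono (Continuous.aestronglyMeasurable ?_) (.of_forall fun z => ?_)
  · have c0 : Continuous fun z : RN N × RN N => ξ - (1 - τ) • z.2 := by fun_prop
    have c1 : Continuous fun z : RN N × RN N => dotR z.2 x :=
      hd.comp (continuous_snd.prodMk continuous_const)
    have c2 : Continuous fun z : RN N × RN N => dotR z.1 (ξ - (1 - τ) • z.2) :=
      hd.comp (continuous_fst.prodMk c0)
    have c3 : Continuous fun z : RN N × RN N => f (x + τ • z.1) := hfc.comp (by fun_prop)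
    have c4 : Continuous fun z : RN N × RN N => ftr f z.2 := hFc.comp continuous_snd
    have c5 := Complex.continuous_conj.comp c4
    simp only [Function.uncurry_def]
    have c6 := Complex.continuous_ofReal.comp c1
    have c7 := Complex.continuous_ofReal.comp c2
    exact ((Complex.continuous_exp.comp (continuous_const.mul c6).neg).mul c5).mul
      ((Complex.continuous_exp.comp (continuous_const.mul c7).neg).mul c3)
  · simp only [Function.uncurry, norm_mul, norm_exp_neg_I_mul, RCLike.norm_conj, one_mul]
    rw [mul_comm]

lemma enorm_wig_le_lintegral_ftr (f : SchwartzMap (RN N) ℂ) {τ : ℝ}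
    (hτ : τ ∈ Set.Ioo (0 : ℝ) 1) (x ξ : RN N) :
    ‖wig τ f x ξ‖ₑ ≤ ENNReal.ofReal (((2 * Real.pi) ^ N)⁻¹ * (((τ - τ ^ 2) ^ N)⁻¹)) *
      ∫⁻ η, ‖ftr f (τ⁻¹ • (ξ + η))‖ₑ * ‖ftr f ((-(1 - τ))⁻¹ • (0 + η))‖ₑ := by
  obtain ⟨h0, h1⟩ := hτ
  have hs : 0 < 1 - τ := sub_pos.2 h1
  have hc := continuous_ftr f
  rw [wig_eq_integral_ftr f h0, enorm_mul]
  have bound : ‖∫ η, (Complex.exp (-(Complex.I * (dotR η x : ℂ))) * (starRingEnd ℂ) (ftr f η)) *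
        ∫ t, Complex.exp (-(Complex.I * (dotR t (ξ - (1 - τ) • η) : ℂ))) * f (x + τ • t)‖ₑ ≤
      ∫⁻ η, ENNReal.ofReal (τ ^ N)⁻¹ * (‖ftr f (τ⁻¹ • (ξ - (1 - τ) • η))‖ₑ * ‖ftr f η‖ₑ) := by
    refine (enorm_integral_le_lintegral_enorm _).trans (le_of_eq ?_)
    refine lintegral_congr fun η => ?_
    rw [← ofReal_norm, norm_mul, norm_mul, norm_exp_neg_I_mul, norm_ftr_affine _ h0,
      RCLike.norm_conj, ← ofReal_norm, ← ofReal_norm, ← ENNReal.ofReal_mul (by positivity),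
      ← ENNReal.ofReal_mul (by positivity)]
    congr 1
    ring
  have hm : Measurable fun η => ‖ftr f (τ⁻¹ • (ξ - (1 - τ) • η))‖ₑ * ‖ftr f η‖ₑ := by
    have : Measurable (ftr f) := hc.measurable
    fun_prop
  rw [lintegral_const_mul _ hm,
    lintegral_eq_smul _ hm (inv_ne_zero (neg_ne_zero.2 hs.ne'))] at bound
  refine (mul_le_mul_right bound _).trans (le_of_eq ?_)
  rw [← mul_assoc, ← mul_assoc]
  congr 1
  · rw [← ofReal_norm, ← ENNReal.ofReal_mul (by positivity), ← ENNReal.ofReal_mul (by positivity)]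
    congr 1
    rw [Complex.norm_real, Real.norm_of_nonneg (by positivity), abs_pow, abs_inv, abs_neg,
      abs_of_pos hs, show τ - τ ^ 2 = τ * (1 - τ) by ring, mul_pow τ, mul_inv (τ ^ N), inv_pow]
    ring
  · refine lintegral_congr fun η => ?_
    congr 3
    · rw [smul_smul, inv_neg, mul_neg, mul_inv_cancel₀ hs.ne']
      simp
    · simp

lemma WeightFunction.w_le_add (W : WeightFunction) {r s t : ℝ} (hr : 0 ≤ r)
    (h : r ≤ max s t) (hs : 0 ≤ s) (ht : 0 ≤ t) : W.w r ≤ W.w s + W.w t := by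
  rcases le_max_iff.1 h with h | h
  · linarith [W.mono hr hs h, W.nonneg t]
  · linarith [W.mono hr ht h, W.nonneg s]

lemma norm_le_max_of_convex {E : Type*} [NormedAddCommGroup E] [NormedSpace ℝ E] {τ : ℝ}
    (hτ : τ ∈ Set.Ioo (0 : ℝ) 1) {x u v : E} (h : x = (1 - τ) • u + τ • v) :
    ‖x‖ ≤ max ‖u‖ ‖v‖ := by
  have h0 := hτ.1.le
  have h1 := sub_nonneg.2 hτ.2.le
  have : ‖x‖ ≤ (1 - τ) * ‖u‖ + τ * ‖v‖ := by
    rw [h]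
    refine (norm_add_le _ _).trans (le_of_eq ?_)
    rw [norm_smul, norm_smul, Real.norm_of_nonneg h0, Real.norm_of_nonneg h1]
  nlinarith [le_max_left ‖u‖ ‖v‖, le_max_right ‖u‖ ‖v‖]

/-- The weight at a phase-space point is controlled by the weights at two points whose components
are combined convexly, with opposite proportions in position and frequency. -/
lemma WeightFunction.two_mul_w_le (W : WeightFunction) {τ : ℝ} (hτ : τ ∈ Set.Ioo (0 : ℝ) 1)
    {z z₁ z₂ : RN N × RN N} (hx : z.1 = (1 - τ) • z₁.1 + τ • z₂.1)
    (hξ : z.2 = (1 - τ) • z₂.2 + τ • z₁.2) :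
    2 * W.w ‖z‖ ≤ 4 * W.K ^ 2 * W.w ‖z₁‖ + 4 * W.K ^ 2 * W.w ‖z₂‖ := by
  have hz : ‖z‖ ≤ max ‖z₁‖ ‖z₂‖ := by
    rw [Prod.norm_def z]
    refine max_le ((norm_le_max_of_convex hτ hx).trans ?_)
      ((norm_le_max_of_convex hτ hξ).trans ?_)
    · exact max_le_max (norm_fst_le _) (norm_fst_le _)
    · rw [max_comm]
      exact max_le_max (norm_snd_le _) (norm_snd_le _)
  have h := W.w_le_add (norm_nonneg _) hz (norm_nonneg _) (norm_nonneg _)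
  have hK : 1 ≤ W.K ^ 2 := one_le_pow₀ W.oneLeK
  nlinarith [W.nonneg ‖z₁‖, W.nonneg ‖z₂‖]

lemma enorm_rihaczek (f : RN N → ℂ) (x ξ : RN N) :
    ‖rihaczek f x ξ‖ₑ = ‖f x‖ₑ * ‖ftr f ξ‖ₑ := by
  rw [rihaczek, enorm_mul, enorm_mul, RCLike.enorm_conj, ← ofReal_norm (Complex.exp _),
    norm_exp_neg_I_mul]
  simp

lemma continuous_weighted_rihaczek (W : WeightFunction) (f : SchwartzMap (RN N) ℂ) (c : ℝ) :
    Continuous fun z : RN N × RN N => Real.exp (c * W.w ‖z‖) * ‖rihaczek f z.1 z.2‖ := by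
  have h1 := W.cont
  have h2 : Continuous fun z : RN N × RN N => f z.1 := f.continuous.comp continuous_fst
  have h3 : Continuous fun z : RN N × RN N => ftr f z.2 :=
    (continuous_ftr f).comp continuous_snd
  have h4 := continuous_dotR (N := N)
  unfold rihaczek
  refine (Real.continuous_exp.comp (continuous_const.mul (h1.comp continuous_norm))).mul ?_
  exact (((Complex.continuous_exp.comp
    (continuous_const.mul (Complex.continuous_ofReal.comp h4)).neg).mul h2).mul
    (Complex.continuous_conj.comp h3)).norm

lemma sq_weighted_wig_le (W : WeightFunction) {τ : ℝ} (hτ : τ ∈ Set.Ioo (0 : ℝ) 1)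
    {p q : ℝ≥0∞} [ENNReal.HolderConjugate p q] {lam : ℝ} (hlam : 0 ≤ lam)
    (f : SchwartzMap (RN N) ℂ) (z : RN N × RN N) :
    ‖Real.exp (lam * W.w ‖z‖) * ‖wig τ f z.1 z.2‖‖ₑ ^ 2 ≤
      ENNReal.ofReal (((2 * Real.pi) ^ N)⁻¹ * (((τ - τ ^ 2) ^ N)⁻¹)) *
      (wnorm W (4 * W.K ^ 2 * lam) volume (fun z : RN N × RN N => rihaczek f z.1 z.2) p *
      wnorm W (4 * W.K ^ 2 * lam) volume (fun z : RN N × RN N => rihaczek f z.1 z.2) q) := by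
  obtain ⟨x, ξ⟩ := z
  set G : RN N × RN N → ℝ :=
    fun z => Real.exp (4 * W.K ^ 2 * lam * W.w ‖z‖) * ‖rihaczek f z.1 z.2‖ with hGdef
  have hG : Continuous G := continuous_weighted_rihaczek W f _
  let φ : RN N × RN N → RN N × RN N := fun s => (x + τ • s.1, τ⁻¹ • (ξ + s.2))
  let ψ : RN N × RN N → RN N × RN N :=
    fun s => (x + (-(1 - τ)) • s.1, (-(1 - τ))⁻¹ • (0 + s.2))
  have hτ0 : τ ≠ 0 := hτ.1.ne'
  have hτ1 : 1 - τ ≠ 0 := (sub_pos.2 hτ.2).ne'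
  have hφ : MeasurePreserving φ volume volume := measurePreserving_hyperbolic x ξ hτ0
  have hψ : MeasurePreserving ψ volume volume :=
    measurePreserving_hyperbolic x 0 (neg_ne_zero.2 hτ1)
  have holder : ∫⁻ s, ‖G (φ s)‖ₑ * ‖G (ψ s)‖ₑ ≤ eLpNorm G p volume * eLpNorm G q volume := by
    have h := eLpNorm_smul_le_mul_eLpNorm (p := p) (q := q) (r := 1)
      (hG.aestronglyMeasurable.comp_measurePreserving hψ)
      (hG.aestronglyMeasurable.comp_measurePreserving hφ)
    rw [eLpNorm_comp_measurePreserving hG.aestronglyMeasurable hφ,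
      eLpNorm_comp_measurePreserving hG.aestronglyMeasurable hψ, eLpNorm_one_eq_lintegral_enorm]
      at h
    simpa [enorm_mul] using h
  have pointwise : ∀ s : RN N × RN N,
      ENNReal.ofReal (Real.exp (lam * W.w ‖(x, ξ)‖)) ^ 2 *
        ((‖f (x + τ • s.1)‖ₑ * ‖f (x - (1 - τ) • s.1)‖ₑ) *
        (‖ftr f (τ⁻¹ • (ξ + s.2))‖ₑ * ‖ftr f ((-(1 - τ))⁻¹ • (0 + s.2))‖ₑ)) ≤
      ‖G (φ s)‖ₑ * ‖G (ψ s)‖ₑ := by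
    intro s
    have hw : 2 * W.w ‖(x, ξ)‖ ≤ 4 * W.K ^ 2 * W.w ‖φ s‖ + 4 * W.K ^ 2 * W.w ‖ψ s‖ := by
      apply W.two_mul_w_le hτ
      · ext i
        simp [φ, ψ]
        ring
      · ext i
        simp only [φ, ψ, Pi.add_apply, Pi.smul_apply, smul_eq_mul, zero_add, inv_neg, neg_mul]
        field_simp
        ring
    have hexp : ENNReal.ofReal (Real.exp (lam * W.w ‖(x, ξ)‖)) ^ 2 ≤
        ENNReal.ofReal (Real.exp (4 * W.K ^ 2 * lam * W.w ‖φ s‖)) *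
        ENNReal.ofReal (Real.exp (4 * W.K ^ 2 * lam * W.w ‖ψ s‖)) := by
      rw [← ENNReal.ofReal_mul (Real.exp_nonneg _), ← Real.exp_add,
        ← ENNReal.ofReal_pow (Real.exp_nonneg _), ← Real.exp_nat_mul]
      refine ENNReal.ofReal_le_ofReal (Real.exp_le_exp.2 ?_)
      push_cast
      nlinarith [mul_le_mul_of_nonneg_left hw hlam]
    have hGe : ∀ z, ‖G z‖ₑ = ENNReal.ofReal (Real.exp (4 * W.K ^ 2 * lam * W.w ‖z‖)) *
        (‖f z.1‖ₑ * ‖ftr f z.2‖ₑ) := by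
      intro z
      rw [hGdef, enorm_mul, enorm_norm, enorm_rihaczek, Real.enorm_of_nonneg (Real.exp_nonneg _)]
    have hsub : x - (1 - τ) • s.1 = (ψ s).1 := by
      simp only [ψ, neg_smul, sub_eq_add_neg x]
    rw [hsub, hGe, hGe]
    refine (mul_le_mul_left hexp _).trans (le_of_eq ?_)
    simp only [φ, ψ]
    ring
  have hfm : Measurable f := f.continuous.measurable
  have hFm : Measurable (ftr f) := (continuous_ftr f).measurable
  calc ‖Real.exp (lam * W.w ‖(x, ξ)‖) * ‖wig τ f x ξ‖‖ₑ ^ 2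
      = ENNReal.ofReal (Real.exp (lam * W.w ‖(x, ξ)‖)) ^ 2 *
          (‖wig τ f x ξ‖ₑ * ‖wig τ f x ξ‖ₑ) := by
        rw [enorm_mul, enorm_norm, Real.enorm_of_nonneg (Real.exp_nonneg _)]
        ring
    _ ≤ ENNReal.ofReal (Real.exp (lam * W.w ‖(x, ξ)‖)) ^ 2 *
          ((∫⁻ t, ‖f (x + τ • t)‖ₑ * ‖f (x - (1 - τ) • t)‖ₑ) *
          (ENNReal.ofReal (((2 * Real.pi) ^ N)⁻¹ * (((τ - τ ^ 2) ^ N)⁻¹)) *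
          ∫⁻ η, ‖ftr f (τ⁻¹ • (ξ + η))‖ₑ * ‖ftr f ((-(1 - τ))⁻¹ • (0 + η))‖ₑ)) := by
        gcongr
        · exact enorm_wig_le_lintegral _ _ _ _
        · exact enorm_wig_le_lintegral_ftr f hτ x ξ
    _ = ENNReal.ofReal (((2 * Real.pi) ^ N)⁻¹ * (((τ - τ ^ 2) ^ N)⁻¹)) *
          ∫⁻ s : RN N × RN N, ENNReal.ofReal (Real.exp (lam * W.w ‖(x, ξ)‖)) ^ 2 *
          ((‖f (x + τ • s.1)‖ₑ * ‖f (x - (1 - τ) • s.1)‖ₑ) *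
          (‖ftr f (τ⁻¹ • (ξ + s.2))‖ₑ * ‖ftr f ((-(1 - τ))⁻¹ • (0 + s.2))‖ₑ)) := by
        rw [lintegral_const_mul _ (by fun_prop), Measure.volume_eq_prod,
          lintegral_prod_mul (f := fun t : RN N => ‖f (x + τ • t)‖ₑ * ‖f (x - (1 - τ) • t)‖ₑ)
            (g := fun η : RN N =>
              ‖ftr f (τ⁻¹ • (ξ + η))‖ₑ * ‖ftr f ((-(1 - τ))⁻¹ • (0 + η))‖ₑ)
            (by fun_prop) (by fun_prop)]
        ring
    _ ≤ _ := by
        gcongr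
        exact (lintegral_mono pointwise).trans holder

end PhaseSpace

theorem stmt9 {N : ℕ} (W : WeightFunction) (τ : ℝ) (hτ : τ ∈ Set.Ioo (0 : ℝ) 1)
    (p q : ℝ≥0∞) (hp : 1 ≤ p) (hpq : 1 / p + 1 / q = 1)
    (lam : ℝ) (hlam : 0 ≤ lam)
    (f : SchwartzMap (RN N) ℂ) (hf : SOmega W ⇑f) :
    (wnorm W lam MeasureTheory.volume (fun z : RN N × RN N => wig τ ⇑f z.1 z.2) ⊤) ^ 2 ≤
      ENNReal.ofReal (((2 * Real.pi) ^ N)⁻¹ * (((τ - τ ^ 2) ^ N)⁻¹) *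
        Real.exp (W.K * (1 + 2 * W.K) * lam)) *
      wnorm W (4 * W.K ^ 2 * lam) MeasureTheory.volume
        (fun z : RN N × RN N => rihaczek ⇑f z.1 z.2) p *
      wnorm W (4 * W.K ^ 2 * lam) MeasureTheory.volume
        (fun z : RN N × RN N => rihaczek ⇑f z.1 z.2) q := by
  have : ENNReal.HolderConjugate p q := ENNReal.holderConjugate_iff.2 (by simpa using hpq)
  set R := wnorm W (4 * W.K ^ 2 * lam) MeasureTheory.volume
    (fun z : RN N × RN N => rihaczek ⇑f z.1 z.2)
  set B := ENNReal.ofReal (((2 * Real.pi) ^ N)⁻¹ * (((τ - τ ^ 2) ^ N)⁻¹)) * (R p * R q)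
  have hsup : wnorm W lam MeasureTheory.volume
      (fun z : RN N × RN N => wig τ ⇑f z.1 z.2) ⊤ ≤ B ^ (1 / 2 : ℝ) := by
    rw [wnorm, eLpNorm_exponent_top]
    refine eLpNormEssSup_le_of_ae_enorm_bound (.of_forall fun z => ?_)
    rw [one_div, ENNReal.le_rpow_inv_iff (by norm_num), ← Nat.cast_ofNat, ENNReal.rpow_natCast]
    exact sq_weighted_wig_le W hτ hlam f z
  have hK := W.oneLeK
  have hexp : 1 ≤ Real.exp (W.K * (1 + 2 * W.K) * lam) := Real.one_le_exp (by positivity)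
  have hτ2 : 0 ≤ τ - τ ^ 2 := by nlinarith [hτ.1, hτ.2]
  calc _ ≤ (B ^ (1 / 2 : ℝ)) ^ 2 := by gcongr
    _ = B := by
      rw [← ENNReal.rpow_natCast, ← ENNReal.rpow_mul]
      norm_num
    _ ≤ _ := by
      rw [mul_assoc]
      refine mul_le_mul_left (ENNReal.ofReal_le_ofReal ?_) _
      exact le_mul_of_one_le_right (by positivity) hexp
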